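/- If Γ1 and Γ2 are orthogonal global bigness notions for a complete first-order theory T, both invariant, and at least one of them is nice, then Γ1 and Γ2 are nicely orthogonal. -/

import Mathlib

namespace Shelah482

open FirstOrder Language Cardinal

universe u

variable {L : FirstOrder.Language.{u, u}} {T : L.Theory} {γ : Type u}

/-- The conjunction of a finite list of formulas. -/
def listConj {α : Type u} : List (L.Formula α) → L.Formula α
  | [] => ⊤
  | φ :: l => φ ⊓ listConj l

/-- The complete type of the tuple `a` over the parameter set `A` in `M`. -/
def typeOf (M : Theory.ModelType.{u, u, u} T) (A : Set M) (a : γ → M) :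
    Set (L.Formula (γ ⊕ ↥A)) :=
  { φ | φ.Realize (Sum.elim a Subtype.val) }

/-- `q` is a complete type over `A` in `M` (in the variables `γ`): a maximal set of
formulas with parameters in `A` which is consistent with the elementary diagram of
`M`, i.e. finitely satisfiable in `M`. -/
def IsCompleteTypeOver (M : Theory.ModelType.{u, u, u} T) (A : Set M)
    (q : Set (L.Formula (γ ⊕ ↥A))) : Prop :=
  (∀ l : List (L.Formula (γ ⊕ ↥A)), (∀ φ ∈ l, φ ∈ q) →
      ∃ x : γ → M, (listConj l).Realize (Sum.elim x Subtype.val)) ∧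
  (∀ φ : L.Formula (γ ⊕ ↥A), φ ∈ q ∨ φ.not ∈ q)

/-- The restriction of a type over `A` to a type over a subset `B ⊆ A`. -/
def restrictT {M : Theory.ModelType.{u, u, u} T} {A B : Set M} (h : B ⊆ A)
    (q : Set (L.Formula (γ ⊕ ↥A))) : Set (L.Formula (γ ⊕ ↥B)) :=
  { φ | φ.relabel (Sum.map id (Set.inclusion h)) ∈ q }

/-- A *global bigness notion* `Γ` for `T` (with the parameter set `A_Γ` absorbed into
the language as constants): an assignment, to each model `M` of `T` and each parameter
set `A ⊆ M`, of a collection of *`Γ`-big* complete types over `A`, satisfying local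
character, extension and existence. -/
structure GlobalBigness (L : FirstOrder.Language.{u, u}) (T : L.Theory) (γ : Type u) :
    Type (u + 1) where
  Big : ∀ (M : Theory.ModelType.{u, u, u} T) (A : Set M),
    Set (L.Formula (γ ⊕ ↥A)) → Prop
  localChar : ∀ (M : Theory.ModelType.{u, u, u} T) (A : Set M)
      (q : Set (L.Formula (γ ⊕ ↥A))), IsCompleteTypeOver M A q →
      (Big M A q ↔ ∀ (B : Set M) (hBA : B ⊆ A), B.Finite → Big M B (restrictT hBA q))
  extension : ∀ (M : Theory.ModelType.{u, u, u} T) (A B : Set M) (hAB : A ⊆ B)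
      (q : Set (L.Formula (γ ⊕ ↥A))), IsCompleteTypeOver M A q → Big M A q →
      ∃ q' : Set (L.Formula (γ ⊕ ↥B)),
        IsCompleteTypeOver M B q' ∧ Big M B q' ∧ restrictT hAB q' = q
  existence : ∀ (M : Theory.ModelType.{u, u, u} T) (A : Set M),
      ∃ q : Set (L.Formula (γ ⊕ ↥A)), IsCompleteTypeOver M A q ∧ Big M A q

/-- The algebraic closure `acl_M(A)` of `A` in `M`: the set of elements of `M`
satisfying some formula `φ(y, ā)` with parameters `ā ⊆ A` which has only finitely many
solutions in `M`. -/
def aclSet (M : Theory.ModelType.{u, u, u} T) (A : Set M) : Set M :=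
  { b | ∃ φ : L.Formula (PUnit.{u + 1} ⊕ ↥A),
      φ.Realize (Sum.elim (fun _ => b) Subtype.val) ∧
      { c : M | φ.Realize (Sum.elim (fun _ => c) Subtype.val) }.Finite }

/-- A global bigness notion is *invariant* if `Γ`-bigness of `tp(ā, A, M)` is preserved
by elementary maps (fixing the parameters `A_Γ`, which are constants, pointwise). -/
def GlobalBigness.Invariant (Γ : GlobalBigness L T γ) : Prop :=
  ∀ (M N : Theory.ModelType.{u, u, u} T) (A : Set M) (B : Set N)
    (a : γ → M) (b : γ → N) (e : ↥A → ↥B), Function.Surjective e →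
    (∀ φ : L.Formula (γ ⊕ ↥A),
      φ.Realize (Sum.elim a Subtype.val) ↔
        (φ.relabel (Sum.map id e)).Realize (Sum.elim b Subtype.val)) →
    (Γ.Big M A (typeOf M A a) ↔ Γ.Big N B (typeOf N B b))

/-- `b` realizes, over the image of `A` under the elementary embedding `emb : M → N`,
the type that `a` realizes over `A` in `M`. -/
def RealizesTypeOf {M N : Theory.ModelType.{u, u, u} T} (emb : M ↪ₑ[L] N)
    (A : Set M) (a : γ → M) (b : γ → N) : Prop :=
  ∀ φ : L.Formula (γ ⊕ ↥A),
    φ.Realize (Sum.elim a Subtype.val) ↔ φ.Realize (Sum.elim b fun x => emb x.val)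

/-- Orthogonality of two (global) bigness notions, given by their bigness predicates
on types: whenever `tp(āˡ, A, M)` is `Γℓ`-big for `ℓ = 1,2`, there are an elementary
extension `N` of `M` and tuples `b̄ˡ` in `N` realizing `tp(āˡ, A, M)` such that
`tp(b̄ˡ, A ∪ b̄^(3−ℓ), N)` is `Γℓ`-big. -/
def Orthogonal {γ₁ γ₂ : Type u}
    (B₁ : ∀ (M : Theory.ModelType.{u, u, u} T) (A : Set M),
      Set (L.Formula (γ₁ ⊕ ↥A)) → Prop)
    (B₂ : ∀ (M : Theory.ModelType.{u, u, u} T) (A : Set M),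
      Set (L.Formula (γ₂ ⊕ ↥A)) → Prop) : Prop :=
  ∀ (M : Theory.ModelType.{u, u, u} T) (A : Set M) (a₁ : γ₁ → M) (a₂ : γ₂ → M),
    B₁ M A (typeOf M A a₁) → B₂ M A (typeOf M A a₂) →
    ∃ (N : Theory.ModelType.{u, u, u} T) (emb : M ↪ₑ[L] N) (b₁ : γ₁ → N) (b₂ : γ₂ → N),
      RealizesTypeOf emb A a₁ b₁ ∧ RealizesTypeOf emb A a₂ b₂ ∧
      B₁ N (⇑emb '' A ∪ Set.range b₂) (typeOf N (⇑emb '' A ∪ Set.range b₂) b₁) ∧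
      B₂ N (⇑emb '' A ∪ Set.range b₁) (typeOf N (⇑emb '' A ∪ Set.range b₁) b₂)

/-- A global bigness notion `Γ` is *nice* if whenever `p ∈ S(A, M)` is `Γ`-big and
`A = acl_M(A)`, then for every ordinal `α` (here: every well-ordered index type `ι`)
there are an elementary extension `N` of `M` and tuples `ā^i ∈ N` (`i ∈ ι`) such that
each `ā^i` realizes `p`, each `tp(ā^i, A ∪ ⋃_{j<i} ā^j, N)` is `Γ`-big, and the sets
`acl_N(A ∪ ā^i) ∖ acl_N(A)` are pairwise disjoint. -/
def GlobalBigness.Nice (Γ : GlobalBigness L T γ) : Prop :=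
  ∀ (M : Theory.ModelType.{u, u, u} T) (A : Set M) (q : Set (L.Formula (γ ⊕ ↥A))),
    IsCompleteTypeOver M A q → Γ.Big M A q → A = aclSet M A →
    ∀ (ι : Type u) [LinearOrder ι] [WellFoundedLT ι],
      ∃ (N : Theory.ModelType.{u, u, u} T) (emb : M ↪ₑ[L] N) (a : ι → γ → N),
        (∀ i, ∀ φ ∈ q, φ.Realize (Sum.elim (a i) fun x => emb x.val)) ∧
        (∀ i : ι, Γ.Big N (⇑emb '' A ∪ ⋃ j < i, Set.range (a j))
          (typeOf N (⇑emb '' A ∪ ⋃ j < i, Set.range (a j)) (a i))) ∧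
        (∀ i j : ι, i ≠ j →
          (aclSet N (⇑emb '' A ∪ Set.range (a i)) \ aclSet N (⇑emb '' A)) ∩
            (aclSet N (⇑emb '' A ∪ Set.range (a j)) \ aclSet N (⇑emb '' A)) = ∅)

/-- `Γ₁` and `Γ₂` (given by their bigness predicates on types) are *nicely orthogonal*:
whenever additionally `A = acl_M(A)`, the witnessing tuples `b̄¹, b̄²` in the definition
of orthogonality can be chosen with `acl_N(A ∪ b̄¹) ∩ acl_N(A ∪ b̄²) = A`. -/
def NicelyOrthogonal {γ₁ γ₂ : Type u}
    (B₁ : ∀ (M : Theory.ModelType.{u, u, u} T) (A : Set M),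
      Set (L.Formula (γ₁ ⊕ ↥A)) → Prop)
    (B₂ : ∀ (M : Theory.ModelType.{u, u, u} T) (A : Set M),
      Set (L.Formula (γ₂ ⊕ ↥A)) → Prop) : Prop :=
  ∀ (M : Theory.ModelType.{u, u, u} T) (A : Set M) (a₁ : γ₁ → M) (a₂ : γ₂ → M),
    A = aclSet M A →
    B₁ M A (typeOf M A a₁) → B₂ M A (typeOf M A a₂) →
    ∃ (N : Theory.ModelType.{u, u, u} T) (emb : M ↪ₑ[L] N) (b₁ : γ₁ → N) (b₂ : γ₂ → N),
      RealizesTypeOf emb A a₁ b₁ ∧ RealizesTypeOf emb A a₂ b₂ ∧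
      B₁ N (⇑emb '' A ∪ Set.range b₂) (typeOf N (⇑emb '' A ∪ Set.range b₂) b₁) ∧
      B₂ N (⇑emb '' A ∪ Set.range b₁) (typeOf N (⇑emb '' A ∪ Set.range b₁) b₂) ∧
      aclSet N (⇑emb '' A ∪ Set.range b₁) ∩ aclSet N (⇑emb '' A ∪ Set.range b₂) =
        ⇑emb '' A

section Helpers

variable {M N K : Theory.ModelType.{u, u, u} T} {α β X : Type u}

/-- The tuples `v` and `w`, possibly in different models, realize the same type over `∅`. -/
def SameType (v : α → M) (w : α → N) : Prop :=
  ∀ φ : L.Formula α, φ.Realize v ↔ φ.Realize w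

lemma SameType.comp {v : α → M} {w : α → N} (h : SameType v w) (σ : β → α) :
    SameType (v ∘ σ) (w ∘ σ) := fun φ => by
  rw [← Formula.realize_relabel, ← Formula.realize_relabel]
  exact h _

lemma SameType.symm {v : α → M} {w : α → N} (h : SameType v w) : SameType w v :=
  fun φ => (h φ).symm

lemma SameType.trans {v : α → M} {w : α → N} {x : α → K} (h : SameType v w)
    (h' : SameType w x) : SameType v x := fun φ => (h φ).trans (h' φ)

lemma sameType_embedding (e : M ↪ₑ[L] N) (v : α → M) : SameType v (e ∘ v) :=
  fun φ => (e.map_formula φ v).symm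

lemma sameType_of_forall_imp {v : α → M} {w : α → N}
    (h : ∀ φ : L.Formula α, φ.Realize v → φ.Realize w) : SameType v w := fun φ => by
  refine ⟨h φ, fun hw => ?_⟩
  by_contra hv
  exact Formula.realize_not.1 (h φ.not (Formula.realize_not.2 hv)) hw

/-- Equality of two entries of a tuple is part of its type. -/
lemma SameType.eq_iff {v : α → M} {w : α → N} (h : SameType v w) (i j : α) :
    v i = v j ↔ w i = w j := by
  have := h (Term.equal (Term.var i) (Term.var j))
  simpa using this

lemma realize_listConj {l : List (L.Formula α)} {v : α → M} :
    (listConj l).Realize v ↔ ∀ φ ∈ l, φ.Realize v := by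
  induction l with
  | nil => simp [listConj]
  | cons φ l ih => simp [listConj, ih]

lemma big_typeOf_congr {A B : Set M} (h : A = B) (Γ : GlobalBigness L T γ) (a : γ → M) :
    Γ.Big M A (typeOf M A a) ↔ Γ.Big M B (typeOf M B a) := by
  subst h; rfl

lemma isCompleteTypeOver_typeOf (A : Set M) (a : γ → M) :
    IsCompleteTypeOver M A (typeOf M A a) := by
  refine ⟨fun l hl => ⟨a, realize_listConj.2 hl⟩, fun φ => ?_⟩
  by_cases h : φ.Realize (Sum.elim a Subtype.val)
  · exact Or.inl h
  · exact Or.inr (Formula.realize_not.2 h)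

lemma restrictT_typeOf {A B : Set M} (h : B ⊆ A) (a : γ → M) :
    restrictT h (typeOf M A a) = typeOf M B a := by
  ext φ
  simp only [restrictT, typeOf, Set.mem_ofPred_eq, Formula.realize_relabel]
  have : (Sum.elim a Subtype.val : γ ⊕ ↥A → M) ∘ Sum.map id (Set.inclusion h) =
      Sum.elim a Subtype.val := by
    funext x; rcases x with x | x <;> rfl
  rw [this]

lemma big_typeOf_iff (Γ : GlobalBigness L T γ) (A : Set M) (a : γ → M) :
    Γ.Big M A (typeOf M A a) ↔ ∀ B ⊆ A, B.Finite → Γ.Big M B (typeOf M B a) := by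
  rw [Γ.localChar M A _ (isCompleteTypeOver_typeOf A a)]
  simp only [restrictT_typeOf]

lemma big_typeOf_mono (Γ : GlobalBigness L T γ) {A B : Set M} (h : B ⊆ A) {a : γ → M}
    (hA : Γ.Big M A (typeOf M A a)) : Γ.Big M B (typeOf M B a) :=
  (big_typeOf_iff Γ B a).2 fun C hC hf =>
    (big_typeOf_iff Γ A a).1 hA C (hC.trans h) hf

/-- Bigness of a realized type depends only on the joint type of the realization and an
enumeration of the parameters. -/
lemma GlobalBigness.Invariant.big_iff {Γ : GlobalBigness L T γ} (hΓ : Γ.Invariant)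
    {A : Set M} {B : Set N} {f : X → M} {g : X → N} {a : γ → M} {b : γ → N}
    (hA : A = Set.range f) (hB : B = Set.range g)
    (h : SameType (Sum.elim a f) (Sum.elim b g)) :
    Γ.Big M A (typeOf M A a) ↔ Γ.Big N B (typeOf N B b) := by
  subst hA hB
  choose s hs using fun y : ↥(Set.range f) => y.2
  refine hΓ M N _ _ a b (fun y => ⟨g (s y), s y, rfl⟩) ?_ ?_
  · rintro ⟨_, x, rfl⟩
    refine ⟨⟨f x, x, rfl⟩, Subtype.ext ?_⟩
    exact (h.eq_iff (Sum.inr _) (Sum.inr x)).1 (hs ⟨f x, x, rfl⟩)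
  · intro φ
    have := h.comp (Sum.map id s) φ
    rw [Formula.realize_relabel]
    convert this using 2
    · funext x; rcases x with x | x
      · rfl
      · exact (hs x).symm
    · funext x; rcases x with x | x <;> rfl

/-- Solvability of a formula is determined by the type of its parameters. -/
lemma SameType.exists_realize {v : X → M} {w : X → N} (h : SameType v w)
    (φ : L.Formula (γ ⊕ X)) {b : γ → N} (hb : φ.Realize (Sum.elim b w)) :
    ∃ a : γ → M, φ.Realize (Sum.elim a v) := by
  classical
  let r : ↥(BoundedFormula.freeVarFinset φ) → X ⊕ ↥(BoundedFormula.freeVarFinset φ) := fun x =>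
    match x with
    | ⟨Sum.inl _, _⟩ => Sum.inr x
    | ⟨Sum.inr y, _⟩ => Sum.inl y
  let ψ : L.Formula (X ⊕ ↥(BoundedFormula.freeVarFinset φ)) := BoundedFormula.restrictFreeVar φ r
  have hN : (ψ.iExs _).Realize w := by
    rw [Formula.realize_iExs]
    refine ⟨fun x => Sum.elim b w x.1, ?_⟩
    refine (BoundedFormula.realize_restrictFreeVar _ ?_).2 hb
    rintro ⟨x | x, hx⟩ <;> rfl
  have hM := (h _).2 hN
  rw [Formula.realize_iExs] at hM
  obtain ⟨i, hi⟩ := hM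
  let a : γ → M := fun x =>
    if hx : Sum.inl x ∈ BoundedFormula.freeVarFinset φ then i ⟨_, hx⟩ else Classical.arbitrary M
  refine ⟨a, (BoundedFormula.realize_restrictFreeVar (Sum.elim a v) ?_).1 hi⟩
  rintro ⟨x | x, hx⟩
  · simp [r, a, hx]
  · rfl

/-- Compactness over a model: a set of formulas with parameters in `M` is realized in an
elementary extension as soon as each finite subset is. -/
lemma exists_extension_realize (p : Set (L.Formula (γ ⊕ M)))
    (h : ∀ s : Finset (L.Formula (γ ⊕ M)), ↑s ⊆ p →
      ∃ (N : Theory.ModelType.{u, u, u} T) (e : M ↪ₑ[L] N) (b : γ → N),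
        ∀ φ ∈ s, φ.Realize (Sum.elim b e)) :
    ∃ (N : Theory.ModelType.{u, u, u} T) (e : M ↪ₑ[L] N) (b : γ → N),
      ∀ φ ∈ p, φ.Realize (Sum.elim b e) := by
  classical
  let d : Set (L.Formula (γ ⊕ M)) := Formula.relabel Sum.inr '' {ψ : L.Formula M | ψ.Realize id}
  let T' : L[[γ ⊕ M]].Theory := Formula.equivSentence '' (p ∪ d)
  have hT' : T'.IsSatisfiable := by
    rw [Theory.isSatisfiable_iff_isFinitelySatisfiable]
    intro T0 hT0
    obtain ⟨s, hs, rfl⟩ := Finset.subset_set_image_iff.1 hT0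
    obtain ⟨N, e, b, hb⟩ := h {φ ∈ s | φ ∈ p} (fun φ hφ => (Finset.mem_filter.1 hφ).2)
    let := constantsOn.structure (Sum.elim b e)
    refine @Theory.Model.isSatisfiable _ _ N _ _ ⟨?_⟩
    intro σ hσ
    obtain ⟨φ, hφ, rfl⟩ := Finset.mem_image.1 hσ
    rw [← Formula.realize_equivSentence_symm N _ (Sum.elim b e), Equiv.symm_apply_apply]
    rcases hs hφ with hp | ⟨ψ, hψ, rfl⟩
    · exact hb φ (Finset.mem_filter.2 ⟨hφ, hp⟩)
    · rw [Formula.realize_relabel]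
      exact (e.map_formula ψ id).2 hψ
  obtain ⟨K⟩ := hT'
  let : L.Structure K := (L.lhomWithConstants (γ ⊕ M)).reduct K
  have hK : ∀ φ ∈ p ∪ d, φ.Realize fun x => (L.con x : K) := fun φ hφ =>
    (Formula.realize_equivSentence K φ).1
      (Theory.realize_sentence_of_mem T' (Set.mem_image_of_mem _ hφ))
  have hd : ∀ ψ : L.Formula M, ψ.Realize id →
      ψ.Realize fun x => (L.con (Sum.inr x : γ ⊕ M) : K) := by
    intro ψ hψ
    have := hK _ (Or.inr ⟨ψ, hψ, rfl⟩)
    rwa [Formula.realize_relabel] at this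
  let e : M ↪ₑ[L] K :=
    { toFun := fun x => (L.con (Sum.inr x : γ ⊕ M) : K)
      map_formula' := by
        intro n φ x
        constructor
        · intro hφ
          by_contra hn
          have := hd (φ.relabel x).not (by
            rw [Formula.realize_not, Formula.realize_relabel]; exact hn)
          rw [Formula.realize_not, Formula.realize_relabel] at this
          exact this hφ
        · intro hφ
          have := hd (φ.relabel x) (by rw [Formula.realize_relabel]; exact hφ)
          rw [Formula.realize_relabel] at this
          exact this }
  have : (K : Type u) ⊨ T := (e.theory_model_iff T).1 inferInstance
  refine ⟨Theory.ModelType.of T K, e, fun x => (L.con (Sum.inl x : γ ⊕ M) : K), fun φ hφ => ?_⟩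
  have hv : (fun x => (L.con x : K)) =
      Sum.elim (fun x => (L.con (Sum.inl x : γ ⊕ M) : K)) e := by
    funext x; rcases x with x | x <;> rfl
  have := hK φ (Or.inl hφ)
  rw [hv] at this
  exact this

/-- A tuple in `N` over parameters `w` is copied, over parameters `v` of the same type in `M`,
to an elementary extension of `M`. -/
lemma SameType.exists_extension {v : X → M} {w : X → N} (h : SameType v w) (b : γ → N) :
    ∃ (K : Theory.ModelType.{u, u, u} T) (e : M ↪ₑ[L] K) (c : γ → K),
      SameType (Sum.elim b w) (Sum.elim c (e ∘ v)) := by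
  classical
  obtain ⟨K, e, c, hc⟩ := exists_extension_realize (M := M)
    (Formula.relabel (Sum.map id v) '' {φ : L.Formula (γ ⊕ X) | φ.Realize (Sum.elim b w)}) (by
      intro s hs
      obtain ⟨t, ht, rfl⟩ := Finset.subset_set_image_iff.1 hs
      obtain ⟨a, ha⟩ := h.exists_realize (listConj t.toList) (b := b)
        (realize_listConj.2 fun φ hφ => ht (Finset.mem_toList.1 hφ))
      refine ⟨M, ElementaryEmbedding.refl L M, a, fun φ hφ => ?_⟩
      obtain ⟨ψ, hψ, rfl⟩ := Finset.mem_image.1 hφ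
      rw [Formula.realize_relabel]
      convert realize_listConj.1 ha ψ (Finset.mem_toList.2 hψ) using 1
      funext x; rcases x with x | x <;> rfl)
  refine ⟨K, e, c, sameType_of_forall_imp fun φ hφ => ?_⟩
  have := hc _ ⟨φ, hφ, rfl⟩
  rw [Formula.realize_relabel] at this
  convert this using 1
  funext x; rcases x with x | x <;> rfl

/-- A formula with finitely many solutions acquires no new ones in an elementary extension. -/
lemma solutions_embedding (e : M ↪ₑ[L] N) (f : X → M) (φ : L.Formula (PUnit.{u + 1} ⊕ X))
    (hfin : {c : M | φ.Realize (Sum.elim (fun _ => c) f)}.Finite) {d : N}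
    (hd : φ.Realize (Sum.elim (fun _ => d) (e ∘ f))) :
    ∃ c : M, φ.Realize (Sum.elim (fun _ => c) f) ∧ e c = d := by
  by_contra! hne
  have hid : SameType (id : M → M) (e : M → N) := sameType_embedding e id
  obtain ⟨y, hy⟩ := hid.exists_realize (γ := PUnit.{u + 1}) (b := fun _ => d)
    (listConj (φ.relabel (Sum.map id f) :: hfin.toFinset.toList.map fun c =>
      (Term.equal (Term.var (Sum.inl PUnit.unit)) (Term.var (Sum.inr c))).not)) (by
    rw [realize_listConj]
    intro ψ hψ
    rcases List.mem_cons.1 hψ with rfl | hψ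
    · rw [Formula.realize_relabel]
      convert hd using 1
      funext x; rcases x with x | x <;> rfl
    · obtain ⟨c, hc, rfl⟩ := List.mem_map.1 hψ
      have hc' : φ.Realize (Sum.elim (fun _ => c) f) := by simpa using hc
      simpa using (hne c hc').symm)
  rw [realize_listConj] at hy
  have h1 := hy _ List.mem_cons_self
  rw [Formula.realize_relabel] at h1
  have h2 : φ.Realize (Sum.elim (fun _ => y PUnit.unit) f) := by
    convert h1 using 1
    funext x; rcases x with x | x <;> rfl
  have h3 := hy _ (List.mem_cons_of_mem _ (List.mem_map.2
    ⟨y PUnit.unit, by simpa using h2, rfl⟩))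
  simp at h3

lemma mem_aclSet_of_formula {A : Set M} {f : X → M} (hA : Set.range f ⊆ A) {b : M}
    (φ : L.Formula (PUnit.{u + 1} ⊕ X)) (hb : φ.Realize (Sum.elim (fun _ => b) f))
    (hfin : {c : M | φ.Realize (Sum.elim (fun _ => c) f)}.Finite) : b ∈ aclSet M A := by
  have key : ∀ c : M, (φ.relabel (Sum.map id fun x => (⟨f x, hA ⟨x, rfl⟩⟩ : ↥A))).Realize
      (Sum.elim (fun _ => c) Subtype.val) ↔ φ.Realize (Sum.elim (fun _ => c) f) := by
    intro c
    rw [Formula.realize_relabel]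
    apply iff_of_eq
    congr 1
    funext x; rcases x with x | x <;> rfl
  exact ⟨_, (key b).2 hb, by simpa only [key] using hfin⟩

lemma exists_formula_of_mem_aclSet {A : Set M} {f : X → M} (hA : A ⊆ Set.range f) {b : M}
    (hb : b ∈ aclSet M A) :
    ∃ φ : L.Formula (PUnit.{u + 1} ⊕ X), φ.Realize (Sum.elim (fun _ => b) f) ∧
      {c : M | φ.Realize (Sum.elim (fun _ => c) f)}.Finite := by
  obtain ⟨φ, hφ, hfin⟩ := hb
  choose s hs using fun y : ↥A => hA y.2
  have key : ∀ c : M, (φ.relabel (Sum.map id s)).Realize (Sum.elim (fun _ => c) f) ↔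
      φ.Realize (Sum.elim (fun _ => c) Subtype.val) := by
    intro c
    rw [Formula.realize_relabel]
    apply iff_of_eq
    congr 1
    funext x; rcases x with x | x
    · rfl
    · exact hs x
  exact ⟨_, (key b).2 hφ, by simpa only [key] using hfin⟩

lemma subset_aclSet (A : Set M) : A ⊆ aclSet M A := fun b hb =>
  ⟨Term.equal (Term.var (Sum.inl PUnit.unit)) (Term.var (Sum.inr ⟨b, hb⟩)), by simp, by simp⟩

lemma aclSet_mono {A B : Set M} (h : A ⊆ B) : aclSet M A ⊆ aclSet M B := by
  intro b hb
  obtain ⟨φ, hφ, hfin⟩ := exists_formula_of_mem_aclSet (f := (Subtype.val : ↥A → M)) (by simp) hb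
  exact mem_aclSet_of_formula (by simpa using h) φ hφ hfin

lemma aclSet_image (e : M ↪ₑ[L] N) (A : Set M) : aclSet N (e '' A) = e '' aclSet M A := by
  have hr : e '' A = Set.range (e ∘ (Subtype.val : ↥A → M)) := by
    rw [Set.range_comp, Subtype.range_coe]
  have key : ∀ (φ : L.Formula (PUnit.{u + 1} ⊕ ↥A)) (c : M),
      φ.Realize (Sum.elim (fun _ => e c) (e ∘ Subtype.val)) ↔
        φ.Realize (Sum.elim (fun _ => c) Subtype.val) := by
    intro φ c
    rw [← e.map_formula]
    apply iff_of_eq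
    congr 1
    funext x; rcases x with x | x <;> rfl
  apply Set.Subset.antisymm
  · intro d hd
    obtain ⟨φ, hφ, hfin⟩ := exists_formula_of_mem_aclSet hr.subset hd
    have hfin' : {c : M | φ.Realize (Sum.elim (fun _ => c) Subtype.val)}.Finite := by
      refine (hfin.preimage e.injective.injOn).subset fun c hc => ?_
      exact (key φ c).2 hc
    obtain ⟨c, hc, rfl⟩ := solutions_embedding e _ φ hfin' hφ
    exact ⟨c, ⟨φ, hc, hfin'⟩, rfl⟩
  · rintro _ ⟨c, ⟨φ, hφ, hfin⟩, rfl⟩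
    refine mem_aclSet_of_formula hr.symm.subset φ ((key φ c).2 hφ) ?_
    refine (hfin.image e).subset fun d hd => ?_
    exact solutions_embedding e _ φ hfin hd

/-- The algebraic closure of the range of `f` injects into a set depending only on the index
type of `f`. -/
lemma exists_injOn_aclSet (f : X → M) :
    ∃ g : M → L.Formula (PUnit.{u + 1} ⊕ X) × ℕ, Set.InjOn g (aclSet M (Set.range f)) := by
  classical
  choose φ hφ hfin using fun b : ↥(aclSet M (Set.range f)) =>
    exists_formula_of_mem_aclSet subset_rfl b.2
  have hcount : ∀ ψ : L.Formula (PUnit.{u + 1} ⊕ X), ∃ n : M → ℕ,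
      {c : M | ψ.Realize (Sum.elim (fun _ => c) f)}.Finite →
        Set.InjOn n {c : M | ψ.Realize (Sum.elim (fun _ => c) f)} := by
    intro ψ
    by_cases h : {c : M | ψ.Realize (Sum.elim (fun _ => c) f)}.Finite
    · obtain ⟨n, hn⟩ := Set.countable_iff_exists_injOn.1 h.countable
      exact ⟨n, fun _ => hn⟩
    · exact ⟨fun _ => 0, fun h' => absurd h' h⟩
  choose n hn using hcount
  refine ⟨fun b => if h : b ∈ aclSet M (Set.range f) then (φ ⟨b, h⟩, n (φ ⟨b, h⟩) b) else
    (⊤, 0), fun b hb c hc hbc => ?_⟩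
  simp only [hb, hc, dif_pos, Prod.mk.injEq] at hbc
  obtain ⟨h1, h2⟩ := hbc
  have hb' := hφ ⟨b, hb⟩
  rw [h1] at hb' h2
  exact hn _ (hfin ⟨c, hc⟩) hb' (hφ ⟨c, hc⟩) h2

end Helpers

section Construction

variable {N : Theory.ModelType.{u, u, u} T} {γ₁ γ₂ ι : Type u}

/-- The set `A` together with the entries of the tuples `a j` for `j ∈ S`. -/
def paramsOn (A : Set N) (a : ι → γ₁ → N) (S : Set ι) : Set N :=
  A ∪ ⋃ j ∈ S, Set.range (a j)

lemma paramsOn_mono (A : Set N) (a : ι → γ₁ → N) {S S' : Set ι} (h : S ⊆ S') :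
    paramsOn A a S ⊆ paramsOn A a S' :=
  Set.union_subset_union_right _ (Set.biUnion_mono h fun _ _ => subset_rfl)

lemma range_subset_paramsOn (A : Set N) (a : ι → γ₁ → N) {S : Set ι} {i : ι} (h : i ∈ S) :
    Set.range (a i) ⊆ paramsOn A a S :=
  (Set.subset_biUnion_of_mem (u := fun j => Set.range (a j)) h).trans Set.subset_union_right

/-- A realization `b` of the type of `b₀` over `A` in an elementary extension of `N` that is
independent from the tuples `a j` for `j` in an initial segment `S`. -/
structure PartialWitness [LinearOrder ι] (Γ₁ : GlobalBigness L T γ₁) (Γ₂ : GlobalBigness L T γ₂)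
    (A : Set N) (a : ι → γ₁ → N) (b₀ : γ₂ → N) where
  S : Set ι
  lower : IsLowerSet S
  K : Theory.ModelType.{u, u, u} T
  e : N ↪ₑ[L] K
  b : γ₂ → K
  base : SameType (Sum.elim b₀ (Subtype.val : ↥A → N)) (Sum.elim b (e ∘ Subtype.val))
  bigRight : Γ₂.Big K (e '' paramsOn A a S) (typeOf K (e '' paramsOn A a S) b)
  bigLeft : ∀ i ∈ S, Γ₁.Big K (e '' paramsOn A a (Set.Iio i) ∪ Set.range b)
    (typeOf K (e '' paramsOn A a (Set.Iio i) ∪ Set.range b) (e ∘ a i))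

lemma image_eq_range {K : Theory.ModelType.{u, u, u} T} (e : N → K) (A : Set N) :
    e '' A = Set.range (e ∘ (Subtype.val : ↥A → N)) := by
  rw [Set.range_comp, Subtype.range_coe]

lemma image_union_range_eq_range {K : Theory.ModelType.{u, u, u} T} (e : N → K) (A : Set N)
    (b : γ → K) :
    e '' A ∪ Set.range b = Set.range (Sum.elim (e ∘ (Subtype.val : ↥A → N)) b) := by
  rw [Set.Sum.elim_range, image_eq_range]

namespace PartialWitness

variable [LinearOrder ι] {Γ₁ : GlobalBigness L T γ₁} {Γ₂ : GlobalBigness L T γ₂}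
  {A : Set N} {a : ι → γ₁ → N} {b₀ : γ₂ → N}

/-- The tuple of `w` together with the images of the elements of `C`. -/
def tuple (w : PartialWitness Γ₁ Γ₂ A a b₀) (C : Set N) : γ₂ ⊕ ↥C → w.K :=
  Sum.elim w.b (w.e ∘ Subtype.val)

/-- `w'` extends `w` if its initial segment is longer and the types agree on that of `w`. -/
def Extends (w w' : PartialWitness Γ₁ Γ₂ A a b₀) : Prop :=
  w.S ⊆ w'.S ∧ SameType (w.tuple (paramsOn A a w.S)) (w'.tuple (paramsOn A a w.S))

lemma Extends.trans {w w' w'' : PartialWitness Γ₁ Γ₂ A a b₀} (h : w.Extends w')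
    (h' : w'.Extends w'') : w.Extends w'' := by
  refine ⟨h.1.trans h'.1, h.2.trans ?_⟩
  convert h'.2.comp (Sum.map id (Set.inclusion (paramsOn_mono A a h.1))) using 1 <;>
  · funext x; rcases x with x | x <;> rfl

lemma Extends.refl (w : PartialWitness Γ₁ Γ₂ A a b₀) : w.Extends w :=
  ⟨subset_rfl, fun _ => Iff.rfl⟩

section Transfer

variable {K : Theory.ModelType.{u, u, u} T} {e : N ↪ₑ[L] K} {b : γ₂ → K}

lemma base_of_sameType (w : PartialWitness Γ₁ Γ₂ A a b₀)
    (h : SameType (w.tuple (paramsOn A a w.S)) (Sum.elim b (e ∘ Subtype.val))) :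
    SameType (Sum.elim b₀ (Subtype.val : ↥A → N)) (Sum.elim b (e ∘ Subtype.val)) := by
  refine w.base.trans ?_
  convert h.comp (Sum.map id (Set.inclusion Set.subset_union_left)) using 1 <;>
  · funext x; rcases x with x | x <;> rfl

lemma bigRight_of_sameType (hInv₂ : Γ₂.Invariant) (w : PartialWitness Γ₁ Γ₂ A a b₀)
    (h : SameType (w.tuple (paramsOn A a w.S)) (Sum.elim b (e ∘ Subtype.val))) :
    Γ₂.Big K (e '' paramsOn A a w.S) (typeOf K (e '' paramsOn A a w.S) b) :=
  (hInv₂.big_iff (image_eq_range _ _) (image_eq_range _ _) h).1 w.bigRight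

lemma bigLeft_of_sameType (hInv₁ : Γ₁.Invariant) (w : PartialWitness Γ₁ Γ₂ A a b₀)
    (h : SameType (w.tuple (paramsOn A a w.S)) (Sum.elim b (e ∘ Subtype.val))) {i : ι}
    (hi : i ∈ w.S) :
    Γ₁.Big K (e '' paramsOn A a (Set.Iio i) ∪ Set.range b)
      (typeOf K (e '' paramsOn A a (Set.Iio i) ∪ Set.range b) (e ∘ a i)) := by
  refine (hInv₁.big_iff (image_union_range_eq_range _ _ _) (image_union_range_eq_range _ _ _)
    ?_).1 (w.bigLeft i hi)
  have hsub : paramsOn A a (Set.Iio i) ⊆ paramsOn A a w.S :=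
    paramsOn_mono A a fun j hj => w.lower (le_of_lt hj) hi
  convert h.comp (Sum.elim
    (fun x => Sum.inr ⟨a i x, range_subset_paramsOn A a hi ⟨x, rfl⟩⟩)
    (Sum.elim (fun x => Sum.inr (Set.inclusion hsub x)) Sum.inl)) using 1 <;>
  · funext x; rcases x with x | x | x <;> rfl

end Transfer

lemma exists_upper_bound (hInv₁ : Γ₁.Invariant) (hInv₂ : Γ₂.Invariant)
    (c : Set (PartialWitness Γ₁ Γ₂ A a b₀)) (hc : IsChain Extends c) (hne : c.Nonempty) :
    ∃ w, ∀ v ∈ c, Extends v w := by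
  let P : PartialWitness Γ₁ Γ₂ A a b₀ → Set (L.Formula (γ₂ ⊕ N)) := fun w =>
    {φ | ∃ ψ : L.Formula (γ₂ ⊕ ↥(paramsOn A a w.S)), ψ.Realize (w.tuple _) ∧
      ∀ (K : Theory.ModelType.{u, u, u} T) (v : γ₂ ⊕ N → K),
        φ.Realize v ↔ ψ.Realize (v ∘ Sum.map id Subtype.val)}
  have htuple : ∀ (K : Theory.ModelType.{u, u, u} T) (e : N ↪ₑ[L] K) (b : γ₂ → K) (C : Set N),
      Sum.elim b e ∘ Sum.map id (Subtype.val : ↥C → N) = Sum.elim b (e ∘ Subtype.val) := by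
    intro K e b C
    funext x; rcases x with x | x <;> rfl
  have hPmono : ∀ v w, Extends v w → P v ⊆ P w := by
    rintro v w h φ ⟨ψ, hψ, hφψ⟩
    refine ⟨ψ.relabel (Sum.map id (Set.inclusion (paramsOn_mono A a h.1))), ?_, fun K x => ?_⟩
    · refine Formula.realize_relabel.2 ?_
      convert (h.2 ψ).1 hψ using 1
      funext x; rcases x with x | x <;> rfl
    · rw [hφψ, Formula.realize_relabel]
      apply iff_of_eq
      congr 1
      funext y; rcases y with y | y <;> rfl
  have : Std.Refl (Extends (Γ₁ := Γ₁) (Γ₂ := Γ₂) (A := A) (a := a) (b₀ := b₀)) := ⟨Extends.refl⟩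
  have hdir : DirectedOn (fun v w => P v ⊆ P w) c := by
    intro v hv w hw
    rcases hc.total hv hw with h | h
    · exact ⟨w, hw, hPmono _ _ h, subset_rfl⟩
    · exact ⟨v, hv, subset_rfl, hPmono _ _ h⟩
  obtain ⟨K, e, b, hb⟩ := exists_extension_realize (⋃ w ∈ c, P w) (by
    intro s hs
    obtain ⟨w, hw, hsw⟩ := hdir.exists_mem_subset_of_finset_subset_biUnion hne hs
    refine ⟨w.K, w.e, w.b, fun φ hφ => ?_⟩
    obtain ⟨ψ, hψ, hφψ⟩ := hsw hφ
    rw [hφψ, htuple]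
    exact hψ)
  have hsame : ∀ w ∈ c, SameType (w.tuple (paramsOn A a w.S)) (Sum.elim b (e ∘ Subtype.val)) := by
    intro w hw
    refine sameType_of_forall_imp fun φ hφ => ?_
    have := hb (φ.relabel (Sum.map id Subtype.val))
      (Set.mem_biUnion hw ⟨φ, hφ, fun K v => Formula.realize_relabel⟩)
    rwa [Formula.realize_relabel, htuple] at this
  obtain ⟨w₀, hw₀⟩ := hne
  refine ⟨⟨⋃ w ∈ c, w.S, isLowerSet_iUnion₂ fun w _ => w.lower, K, e, b,
    w₀.base_of_sameType (hsame w₀ hw₀), ?_, ?_⟩, fun w hw => ?_⟩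
  · rw [big_typeOf_iff]
    intro B hB hfin
    obtain ⟨t, ht, rfl⟩ := Set.subset_image_iff.1 hB
    have htfin : t.Finite := hfin.of_finite_image e.injective.injOn
    obtain ⟨w, hw, htw⟩ : ∃ w ∈ c, t ⊆ paramsOn A a w.S := by
      have hdir' : DirectedOn (fun v w => paramsOn A a v.S ⊆ paramsOn A a w.S) c := by
        intro v hv w hw
        rcases hc.total hv hw with h | h
        · exact ⟨w, hw, paramsOn_mono A a h.1, subset_rfl⟩
        · exact ⟨v, hv, subset_rfl, paramsOn_mono A a h.1⟩
      have hsub : (↑htfin.toFinset : Set N) ⊆ ⋃ w ∈ c, paramsOn A a w.S := by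
        intro x hx
        rcases ht (by simpa using hx) with h | h
        · exact Set.mem_biUnion hw₀ (Or.inl h)
        · simp only [Set.mem_iUnion] at h
          obtain ⟨j, ⟨w, hw, hj⟩, hx⟩ := h
          exact Set.mem_biUnion hw (range_subset_paramsOn A a hj hx)
      obtain ⟨w, hw, h⟩ := hdir'.exists_mem_subset_of_finset_subset_biUnion ⟨w₀, hw₀⟩ hsub
      exact ⟨w, hw, by simpa using h⟩
    exact big_typeOf_mono Γ₂ (Set.image_mono htw)
      (w.bigRight_of_sameType hInv₂ (hsame w hw))
  · intro i hi
    simp only [Set.mem_iUnion] at hi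
    obtain ⟨w, hw, hi⟩ := hi
    exact w.bigLeft_of_sameType hInv₁ (hsame w hw) hi
  · exact ⟨Set.subset_biUnion_of_mem (u := fun w : PartialWitness Γ₁ Γ₂ A a b₀ => w.S) hw,
      hsame w hw⟩

lemma exists_proper_extension (hInv₁ : Γ₁.Invariant) (hInv₂ : Γ₂.Invariant)
    (hOrth : Orthogonal Γ₁.Big Γ₂.Big)
    (ha : ∀ i, Γ₁.Big N (paramsOn A a (Set.Iio i)) (typeOf N (paramsOn A a (Set.Iio i)) (a i)))
    (w : PartialWitness Γ₁ Γ₂ A a b₀) {i : ι} (hi : w.S = Set.Iio i) :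
    ∃ w' : PartialWitness Γ₁ Γ₂ A a b₀, w.Extends w' ∧ i ∈ w'.S := by
  obtain ⟨K₁, e₁, b₁, b₂, h₁, h₂, hbig₁, hbig₂⟩ := hOrth w.K (w.e '' paramsOn A a (Set.Iio i))
    (w.e ∘ a i) w.b
    ((hInv₁.big_iff Subtype.range_coe.symm (image_eq_range _ _) (by
      convert sameType_embedding w.e (Sum.elim (a i) Subtype.val) using 1
      funext x; rcases x with x | x <;> rfl)).1 (ha i))
    (hi ▸ w.bigRight)
  let C := paramsOn A a (Set.Iio i)
  let img : ↥C → ↥(w.e '' C) := fun x => ⟨w.e x, x, x.2, rfl⟩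
  have h₁' : SameType (Sum.elim (a i) (Subtype.val : ↥C → N))
      (Sum.elim b₁ (e₁ ∘ w.e ∘ Subtype.val)) := by
    refine (sameType_embedding w.e _).trans ?_
    convert SameType.comp h₁ (Sum.map id img) using 1 <;>
    · funext x; rcases x with x | x <;> rfl
  obtain ⟨K, e, b, hb⟩ := h₁'.exists_extension b₂
  have hwb : SameType (w.tuple (paramsOn A a w.S)) (Sum.elim b (e ∘ Subtype.val)) := by
    rw [hi]
    have h₂' : SameType (w.tuple C) (Sum.elim b₂ (e₁ ∘ w.e ∘ (Subtype.val : ↥C → N))) := by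
      convert SameType.comp h₂ (Sum.map id img) using 1 <;>
      · funext x; rcases x with x | x <;> rfl
    refine h₂'.trans ?_
    convert hb.comp (Sum.map id Sum.inr) using 1 <;>
    · funext x; rcases x with x | x <;> rfl
  have hS : paramsOn A a (Set.Iic i) = C ∪ Set.range (a i) := by
    simp only [C, paramsOn, Set.union_assoc]
    congr 1
    rw [← Set.Iio_insert, Set.biUnion_insert, Set.union_comm]
  have himg : e₁ '' (w.e '' C) = Set.range (e₁ ∘ w.e ∘ (Subtype.val : ↥C → N)) := by
    rw [Set.range_comp, Set.range_comp, Subtype.range_coe]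
  refine ⟨⟨Set.Iic i, isLowerSet_Iic i, K, e, b, w.base_of_sameType hwb, ?_, ?_⟩, ?_,
    Set.mem_Iic.2 le_rfl⟩
  · refine (hInv₂.big_iff (f := Sum.elim (e₁ ∘ w.e ∘ (Subtype.val : ↥C → N)) b₁)
      (g := Sum.elim (e ∘ (Subtype.val : ↥C → N)) (e ∘ a i)) ?_ ?_ ?_).1 hbig₂
    · rw [Set.Sum.elim_range, ← himg]
    · rw [Set.Sum.elim_range, hS, Set.image_union, image_eq_range, Set.range_comp e (a i)]
    · convert hb.comp (Sum.elim Sum.inl (Sum.elim (Sum.inr ∘ Sum.inr) (Sum.inr ∘ Sum.inl)))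
        using 1 <;>
      · funext x; rcases x with x | x | x <;> rfl
  · intro j hj
    rcases (Set.mem_Iic.1 hj).lt_or_eq with hj | rfl
    · exact w.bigLeft_of_sameType hInv₁ hwb (by rw [hi]; exact hj)
    · refine (hInv₁.big_iff (f := Sum.elim (e₁ ∘ w.e ∘ (Subtype.val : ↥C → N)) b₂)
        (g := Sum.elim (e ∘ (Subtype.val : ↥C → N)) b) ?_ ?_ ?_).1 hbig₁
      · rw [Set.Sum.elim_range, ← himg]
      · rw [Set.Sum.elim_range, image_eq_range]
      · convert hb.comp (Sum.elim (Sum.inr ∘ Sum.inl) (Sum.elim (Sum.inr ∘ Sum.inr) Sum.inl))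
          using 1 <;>
        · funext x; rcases x with x | x | x <;> rfl
  · exact ⟨hi.subset.trans Set.Iio_subset_Iic_self, hwb⟩

lemma exists_total [WellFoundedLT ι] (hInv₁ : Γ₁.Invariant) (hInv₂ : Γ₂.Invariant)
    (hOrth : Orthogonal Γ₁.Big Γ₂.Big)
    (ha : ∀ i, Γ₁.Big N (paramsOn A a (Set.Iio i)) (typeOf N (paramsOn A a (Set.Iio i)) (a i)))
    (hb₀ : Γ₂.Big N A (typeOf N A b₀)) :
    ∃ w : PartialWitness Γ₁ Γ₂ A a b₀, w.S = Set.univ := by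
  have hA : paramsOn A a ∅ = A := by simp [paramsOn]
  let w₀ : PartialWitness Γ₁ Γ₂ A a b₀ :=
    { S := ∅
      lower := isLowerSet_empty
      K := N
      e := ElementaryEmbedding.refl L N
      b := b₀
      base := fun _ => Iff.rfl
      bigRight := (big_typeOf_congr (by rw [hA]; exact (Set.image_id A).symm) Γ₂ b₀).1 hb₀
      bigLeft := fun _ hi => hi.elim }
  have : Nonempty (PartialWitness Γ₁ Γ₂ A a b₀) := ⟨w₀⟩
  obtain ⟨w, hw⟩ := exists_maximal_of_nonempty_chains_bounded
    (exists_upper_bound (Γ₁ := Γ₁) (Γ₂ := Γ₂) (A := A) (a := a) (b₀ := b₀) hInv₁ hInv₂)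
    Extends.trans
  refine ⟨w, by_contra fun hne => ?_⟩
  have hne' : (w.Sᶜ).Nonempty := Set.nonempty_compl.2 hne
  obtain ⟨i, hi, hmin⟩ := WellFounded.has_min (wellFounded_lt (α := ι)) _ hne'
  have hS : w.S = Set.Iio i := by
    ext j
    constructor
    · intro hj
      exact lt_of_not_ge fun hij => hi (w.lower hij hj)
    · intro hj
      by_contra hj'
      exact hmin j hj' hj
  obtain ⟨w', hww', hi'⟩ := w.exists_proper_extension hInv₁ hInv₂ hOrth ha hS
  exact hi ((hw w' hww').1 hi')

end PartialWitness

/-- If `Γ₁` is nice, orthogonality can be improved to nice orthogonality. -/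
lemma GlobalBigness.Nice.nicelyOrthogonal {Γ₁ : GlobalBigness L T γ₁} {Γ₂ : GlobalBigness L T γ₂}
    (hNice : Γ₁.Nice) (hInv₁ : Γ₁.Invariant) (hInv₂ : Γ₂.Invariant)
    (hOrth : Orthogonal Γ₁.Big Γ₂.Big) : NicelyOrthogonal Γ₁.Big Γ₂.Big := by
  intro M A a₁ a₂ hA h₁ h₂
  let W : Type u := L.Formula (PUnit.{u + 1} ⊕ (↥A ⊕ γ₂)) × ℕ
  obtain ⟨ι, f, hf, _, _⟩ : ∃ (ι : Type u) (f : Set W → ι) (_ : Function.Injective f)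
      (_ : LinearOrder ι), WellFoundedLT ι :=
    ⟨Set W, id, Function.injective_id, exists_wellFoundedLT _⟩
  obtain ⟨N, e₀, a, hreal, hbig, hdisj⟩ :=
    hNice M A _ (isCompleteTypeOver_typeOf A a₁) h₁ hA ι
  obtain ⟨w, hw⟩ := PartialWitness.exists_total (A := e₀ '' A) (a := a) (b₀ := e₀ ∘ a₂)
    hInv₁ hInv₂ hOrth hbig
    ((hInv₂.big_iff Subtype.range_coe.symm (image_eq_range _ _) (by
      convert sameType_embedding e₀ (Sum.elim a₂ Subtype.val) using 1
      funext x; rcases x with x | x <;> rfl)).1 h₂)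
  have hcl : aclSet N (e₀ '' A) = e₀ '' A := by rw [aclSet_image, ← hA]
  obtain ⟨i, hi⟩ : ∃ i, aclSet w.K (w.e '' (e₀ '' A ∪ Set.range (a i))) ∩
      aclSet w.K (w.e '' (e₀ '' A) ∪ Set.range w.b) ⊆ w.e '' (e₀ '' A) := by
    by_contra! hno
    have hno' : ∀ i, ∃ x : N, x ∈ aclSet N (e₀ '' A ∪ Set.range (a i)) ∧ x ∉ e₀ '' A ∧
        w.e x ∈ aclSet w.K (w.e '' (e₀ '' A) ∪ Set.range w.b) := by
      intro i
      obtain ⟨y, ⟨hy₁, hy₂⟩, hy₃⟩ := Set.not_subset.1 (hno i)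
      rw [aclSet_image] at hy₁
      obtain ⟨x, hx, rfl⟩ := hy₁
      exact ⟨x, hx, fun h => hy₃ ⟨x, h, rfl⟩, hy₂⟩
    choose x hx₁ hx₂ hx₃ using hno'
    obtain ⟨g, hg⟩ := exists_injOn_aclSet
      (Sum.elim (fun y : ↥A => w.e (e₀ y)) w.b : ↥A ⊕ γ₂ → w.K)
    have hrange : w.e '' (e₀ '' A) ∪ Set.range w.b =
        Set.range (Sum.elim (fun y : ↥A => w.e (e₀ y)) w.b) := by
      rw [Set.Sum.elim_range]
      congr 1
      exact (Set.image_image _ _ _).trans (Set.image_eq_range _ _)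
    rw [← hrange] at hg
    refine Function.cantor_injective (fun s : Set W => g (w.e (x (f s)))) fun s t hst => hf ?_
    have hxij : x (f s) = x (f t) := w.e.injective (hg (hx₃ _) (hx₃ _) hst)
    by_contra hne
    have hmem : x (f s) ∈ (∅ : Set N) := by
      rw [← hdisj _ _ hne, hcl]
      exact ⟨⟨hx₁ _, hx₂ _⟩, hxij ▸ hx₁ _, hx₂ _⟩
    exact hmem
  have himg : (w.e.comp e₀) '' A = w.e '' (e₀ '' A) := by
    rw [Set.image_image]; rfl
  refine ⟨w.K, w.e.comp e₀, w.e ∘ a i, w.b, ?_, ?_, ?_, ?_, ?_⟩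
  · have h : SameType (Sum.elim a₁ (Subtype.val : ↥A → M))
        (Sum.elim (a i) (e₀ ∘ Subtype.val)) := sameType_of_forall_imp (hreal i)
    refine h.trans ?_
    convert sameType_embedding w.e _ using 1
    funext x; rcases x with x | x <;> rfl
  · refine (sameType_embedding e₀ _).trans ?_
    convert w.base.comp (Sum.map id fun y : ↥A => (⟨e₀ y, y, y.2, rfl⟩ : ↥(e₀ '' A))) using 1 <;>
    · funext x; rcases x with x | x <;> rfl
  · rw [himg]
    exact big_typeOf_mono Γ₁
      (Set.union_subset_union_left _ (Set.image_mono Set.subset_union_left))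
      (w.bigLeft i (hw ▸ Set.mem_univ i))
  · rw [himg]
    refine big_typeOf_mono Γ₂ ?_ w.bigRight
    rw [Set.range_comp, ← Set.image_union]
    exact Set.image_mono (Set.union_subset Set.subset_union_left
      (range_subset_paramsOn _ _ (hw ▸ Set.mem_univ i)))
  · rw [himg]
    apply Set.Subset.antisymm
    · rw [Set.range_comp w.e (a i), ← Set.image_union]
      exact hi
    · exact fun y hy => ⟨subset_aclSet _ (Or.inl hy), subset_aclSet _ (Or.inl hy)⟩

end Construction

lemma Orthogonal.symm {γ₁ γ₂ : Type u} {Γ₁ : GlobalBigness L T γ₁} {Γ₂ : GlobalBigness L T γ₂}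
    (h : Orthogonal Γ₁.Big Γ₂.Big) : Orthogonal Γ₂.Big Γ₁.Big := by
  intro M A a₁ a₂ h₁ h₂
  obtain ⟨N, e, b₁, b₂, hb₁, hb₂, hbig₁, hbig₂⟩ := h M A a₂ a₁ h₂ h₁
  exact ⟨N, e, b₂, b₁, hb₂, hb₁, hbig₂, hbig₁⟩

lemma NicelyOrthogonal.symm {γ₁ γ₂ : Type u} {Γ₁ : GlobalBigness L T γ₁}
    {Γ₂ : GlobalBigness L T γ₂} (h : NicelyOrthogonal Γ₁.Big Γ₂.Big) :
    NicelyOrthogonal Γ₂.Big Γ₁.Big := by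
  intro M A a₁ a₂ hA h₁ h₂
  obtain ⟨N, e, b₁, b₂, hb₁, hb₂, hbig₁, hbig₂, hacl⟩ := h M A a₂ a₁ hA h₂ h₁
  exact ⟨N, e, b₂, b₁, hb₂, hb₁, hbig₂, hbig₁, by rw [Set.inter_comm]; exact hacl⟩

/-!
Statement 5 (Claim 1.17(3)): if `Γ₁, Γ₂` are orthogonal invariant global bigness
notions and at least one of them is nice, then `Γ₁, Γ₂` are nicely orthogonal.
-/
theorem nicelyOrthogonal_of_orthogonal {γ₁ γ₂ : Type u} (hT : T.IsComplete)
    (Γ₁ : GlobalBigness L T γ₁) (Γ₂ : GlobalBigness L T γ₂)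
    (hInv₁ : Γ₁.Invariant) (hInv₂ : Γ₂.Invariant)
    (hNice : Γ₁.Nice ∨ Γ₂.Nice)
    (hOrth : Orthogonal Γ₁.Big Γ₂.Big) :
    NicelyOrthogonal Γ₁.Big Γ₂.Big := by
  rcases hNice with h | h
  · exact h.nicelyOrthogonal hInv₁ hInv₂ hOrth
  · exact (h.nicelyOrthogonal hInv₂ hInv₁ hOrth.symm).symm

end Shelah482
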